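/- For every f ∈ H*(GQ_{2n−1}) there exist polynomials h_1, …, h_{2n} ∈ R such that f = h_1 + h_2·M_1 + h_3·M_1M_2 + ⋯ + h_n·M_1⋯M_{n−1} + h_{n+1}·Δ_{{n+1,…,2n}} + h_{n+2}·Δ_{{n+2,…,2n}} + ⋯ + h_{2n}·Δ_{{2n}}, where each h_i acts as the constant function with value h_i and products of the M_j are pointwise. -/

import Mathlib

open MvPolynomial Finset

noncomputable section

abbrev Rr (n : ℕ) := MvPolynomial (Fin n) ℤ

/-- The "opposite" vertex: 0-indexed version of i ↦ 2n+1−i. -/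
def bar {n : ℕ} (i : Fin (2*n)) : Fin (2*n) :=
  ⟨2*n - 1 - i.val, by have := i.isLt; omega⟩

/-- The weight α_i (0-indexed): α_i = X i for i < n, and α_i = −α_{bar i} otherwise. -/
def av {n : ℕ} (i : Fin (2*n)) : Rr n :=
  if h : i.val < n then X ⟨i.val, h⟩
  else - X ⟨2*n - 1 - i.val, by have := i.isLt; omega⟩

/-- The axial function α(ij). -/
def ax {n : ℕ} (i j : Fin (2*n)) : Rr n :=
  if j = bar i then - av i else - av i + av j

/-- The class M_v. -/
def Mv {n : ℕ} (v : Fin (2*n)) : Fin (2*n) → Rr n := fun j =>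
  if j = v then 0 else if j = bar v then 2 * av v else - av j + av v

/-- The class Q. -/
def Qf {n : ℕ} : Fin (2*n) → Rr n := fun j => - av j

/-- Independence: K contains no pair {i, bar i}. -/
def indep {n : ℕ} (K : Finset (Fin (2*n))) : Prop :=
  ∀ i : Fin (2*n), ¬ ({i, bar i} : Finset (Fin (2*n))) ⊆ K

/-- The class Δ_K. -/
def Del {n : ℕ} (K : Finset (Fin (2*n))) : Fin (2*n) → Rr n := fun j =>
  if j ∈ K then ∏ k ∈ Kᶜ, ax j k else 0

/-- The class Δ'_K. -/
def Del' {n : ℕ} (K : Finset (Fin (2*n))) : Fin (2*n) → Rr n := fun j =>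
  if j ∈ K then ∏ k ∈ (K ∪ {bar j})ᶜ, ax j k else 0

/-- The graph equivariant cohomology H*(GQ_{2n−1}) as a subring of the ring of
functions V → R with pointwise operations. -/
def HGQ (n : ℕ) : Subring (Fin (2*n) → Rr n) where
  carrier := {f | ∀ i j : Fin (2*n), i ≠ j → ax i j ∣ f i - f j}
  zero_mem' := fun i j _ => by simp
  one_mem' := fun i j _ => by simp
  add_mem' := by
    intro a b ha hb i j h
    have e : (a + b) i - (a + b) j = (a i - a j) + (b i - b j) := by
      simp only [Pi.add_apply]; ring
    rw [e]; exact dvd_add (ha i j h) (hb i j h)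
  neg_mem' := by
    intro a ha i j h
    have e : (-a) i - (-a) j = -(a i - a j) := by
      simp only [Pi.neg_apply]; ring
    rw [e]; exact dvd_neg.mpr (ha i j h)
  mul_mem' := by
    intro a b ha hb i j h
    have e : (a * b) i - (a * b) j = a i * (b i - b j) + (a i - a j) * b j := by
      simp only [Pi.mul_apply]; ring
    rw [e]; exact dvd_add ((hb i j h).mul_left _) ((ha i j h).mul_right _)

/-- The graph equivariant cohomology H*(GQ_{2n−2}) (edges i j with j ≠ bar i only). -/
def HGQe (n : ℕ) : Subring (Fin (2*n) → Rr n) where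
  carrier := {f | ∀ i j : Fin (2*n), i ≠ j → j ≠ bar i → ax i j ∣ f i - f j}
  zero_mem' := fun i j _ _ => by simp
  one_mem' := fun i j _ _ => by simp
  add_mem' := by
    intro a b ha hb i j h h'
    have e : (a + b) i - (a + b) j = (a i - a j) + (b i - b j) := by
      simp only [Pi.add_apply]; ring
    rw [e]; exact dvd_add (ha i j h h') (hb i j h h')
  neg_mem' := by
    intro a ha i j h h'
    have e : (-a) i - (-a) j = -(a i - a j) := by
      simp only [Pi.neg_apply]; ring
    rw [e]; exact dvd_neg.mpr (ha i j h h')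
  mul_mem' := by
    intro a b ha hb i j h h'
    have e : (a * b) i - (a * b) j = a i * (b i - b j) + (a i - a j) * b j := by
      simp only [Pi.mul_apply]; ring
    rw [e]; exact dvd_add ((hb i j h h').mul_left _) ((ha i j h h').mul_right _)


/-- The 2n functions 1, M_1, M_1M_2, …, M_1⋯M_{n−1}, Δ_{{n+1,…,2n}}, …, Δ_{{2n}}
(0-indexed by k : Fin (2n)). -/
def basisFun {n : ℕ} (k : Fin (2*n)) : Fin (2*n) → Rr n :=
  if k.val < n then ∏ j ∈ univ.filter (fun j : Fin (2*n) => j.val < k.val), Mv j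
  else Del (univ.filter (fun j : Fin (2*n) => k.val ≤ j.val))

/-- The variable underlying `av i`. -/
def avIdx {n : ℕ} (i : Fin (2*n)) : Fin n :=
  if h : i.val < n then ⟨i.val, h⟩ else ⟨2*n - 1 - i.val, by have := i.isLt; omega⟩

/-- The sign of `av i`. -/
def avSign {n : ℕ} (i : Fin (2*n)) : ℤ := if i.val < n then 1 else -1

lemma av_eq {n : ℕ} (i : Fin (2*n)) : av i = C (avSign i) * X (avIdx i) := by
  unfold av avSign avIdx
  split_ifs <;> simp

lemma isUnit_avSign {n : ℕ} (i : Fin (2*n)) : IsUnit (avSign i) := by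
  unfold avSign
  split_ifs <;> simp

lemma avSign_mul_self {n : ℕ} (i : Fin (2*n)) : avSign i * avSign i = 1 := by
  unfold avSign
  split_ifs <;> simp

lemma bar_bar {n : ℕ} (i : Fin (2*n)) : bar (bar i) = i := by
  ext
  have := i.isLt
  simp only [bar]
  omega

lemma bar_ne {n : ℕ} (i : Fin (2*n)) : bar i ≠ i := by
  intro h
  have h := congrArg Fin.val h
  have := i.isLt
  simp only [bar] at h
  omega

lemma av_bar {n : ℕ} (i : Fin (2*n)) : av (bar i) = - av i := by
  have hi := i.isLt
  unfold av bar
  by_cases h : i.val < n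
  · rw [dif_neg (by simp only; omega), dif_pos h]
    congr 3
    simp only
    omega
  · rw [dif_pos (by simp only; omega), dif_neg h, neg_neg]

lemma avIdx_eq_iff {n : ℕ} (i j : Fin (2*n)) : avIdx i = avIdx j ↔ i = j ∨ i = bar j := by
  have hi := i.isLt
  have hj := j.isLt
  simp only [avIdx, bar, Fin.ext_iff]
  split_ifs <;> simp only <;> omega

lemma Mv_apply {n : ℕ} (v j : Fin (2*n)) : Mv v j = - av j + av v := by
  unfold Mv
  split_ifs with h h'
  · rw [h]; ring
  · rw [h', av_bar]; ring
  · rfl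

lemma ax_swap {n : ℕ} (i j : Fin (2*n)) : ax j i = - ax i j := by
  have e : i = bar j ↔ j = bar i :=
    ⟨fun h => by rw [h, bar_bar], fun h => by rw [h, bar_bar]⟩
  simp only [ax, e]
  split_ifs with h
  · rw [h, av_bar]
  · ring

lemma ax_dvd_sub {n : ℕ} (i j : Fin (2*n)) : ax i j ∣ av i - av j := by
  unfold ax
  split_ifs with h
  · rw [h, av_bar]
    exact ⟨-2, by ring⟩
  · exact ⟨-1, by ring⟩

lemma coeff_av {n : ℕ} (i : Fin (2*n)) (m : Fin n) :
    coeff (Finsupp.single m 1) (av i) = if avIdx i = m then avSign i else 0 := by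
  rw [av_eq, coeff_C_mul, coeff_X]
  simp [Finsupp.single_left_inj]

lemma coeff_ax {n : ℕ} {k j : Fin (2*n)} (h : j ≠ k) :
    coeff (Finsupp.single (avIdx k) 1) (ax k j) = - avSign k := by
  unfold ax
  split_ifs with hb
  · simp [coeff_av]
  · have : avIdx j ≠ avIdx k := by
      rw [Ne, avIdx_eq_iff]; tauto
    simp [coeff_av, this]

lemma totalDegree_av_le {n : ℕ} (i : Fin (2*n)) : (av i).totalDegree ≤ 1 := by
  rw [av_eq]
  refine (totalDegree_mul _ _).trans ?_
  rw [totalDegree_C, totalDegree_X]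

lemma totalDegree_ax {n : ℕ} {k j : Fin (2*n)} (h : j ≠ k) : (ax k j).totalDegree = 1 := by
  apply le_antisymm
  · unfold ax
    split_ifs
    · rw [totalDegree_neg]
      exact totalDegree_av_le k
    · refine (totalDegree_add _ _).trans (max_le ?_ (totalDegree_av_le j))
      rw [totalDegree_neg]
      exact totalDegree_av_le k
  · have hs : Finsupp.single (avIdx k) 1 ∈ (ax k j).support := by
      rw [mem_support_iff, coeff_ax h]
      exact neg_ne_zero.mpr (isUnit_avSign k).ne_zero
    simpa using le_totalDegree hs

lemma irreducible_ax {n : ℕ} {k j : Fin (2*n)} (h : j ≠ k) : Irreducible (ax k j) := by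
  refine irreducible_of_totalDegree_eq_one (totalDegree_ax h) fun x hx => ?_
  have := hx (Finsupp.single (avIdx k) 1)
  rw [coeff_ax h, dvd_neg] at this
  exact isUnit_of_dvd_unit this (isUnit_avSign k)

lemma not_ax_dvd_ax {n : ℕ} {k i j : Fin (2*n)} (hi : i ≠ k) (hj : j ≠ k) (hij : i ≠ j) :
    ¬ ax k j ∣ ax k i := by
  intro hd
  by_cases hb : j = bar k
  · have hib : i ≠ bar k := hb ▸ hij
    have hidx : avIdx i ≠ avIdx k := by
      rw [Ne, avIdx_eq_iff]; tauto
    have := map_dvd (eval fun m => if m = avIdx k then (0 : ℤ) else 1) hd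
    simp only [ax, if_pos hb, if_neg hib, av_eq, map_neg, map_add, map_mul, eval_C, eval_X,
      if_true, if_neg hidx, mul_zero, mul_one, neg_zero, zero_add, zero_dvd_iff] at this
    exact (isUnit_avSign i).ne_zero this
  · have hidx : avIdx j ≠ avIdx k := by
      rw [Ne, avIdx_eq_iff]; tauto
    have := map_dvd (eval fun m => if m = avIdx k then avSign k else
      if m = avIdx j then avSign j else (0 : ℤ)) hd
    by_cases hib : i = bar k
    · simp [ax, hb, hib, av_eq, hidx, avSign_mul_self] at this
    · have hidx' : avIdx i ≠ avIdx k := by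
        rw [Ne, avIdx_eq_iff]; tauto
      by_cases hibj : i = bar j
      · have h1 : eval (fun m => if m = avIdx k then avSign k else
            if m = avIdx j then avSign j else (0 : ℤ)) (av i) = -1 := by
          rw [hibj, av_bar]
          simp [av_eq, hidx, avSign_mul_self]
        simp only [ax, if_neg hib, map_add, h1] at this
        simp [hb, av_eq, hidx, avSign_mul_self] at this
      · have hidx'' : avIdx i ≠ avIdx j := by
          rw [Ne, avIdx_eq_iff]; tauto
        simp [ax, hb, hib, av_eq, hidx, hidx', hidx'', avSign_mul_self] at this

lemma prod_ax_dvd {n : ℕ} {k : Fin (2*n)} {s : Finset (Fin (2*n))} (hs : k ∉ s) {p : Rr n}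
    (h : ∀ j ∈ s, ax k j ∣ p) : ∏ j ∈ s, ax k j ∣ p := by
  refine Finset.prod_dvd_of_isRelPrime (fun i hi j hj hij => ?_) h
  have hik : i ≠ k := fun e => hs (e ▸ hi)
  have hjk : j ≠ k := fun e => hs (e ▸ hj)
  exact (irreducible_ax hik).isRelPrime_iff_not_dvd.mpr (not_ax_dvd_ax hjk hik hij.symm)

lemma Mv_mem {n : ℕ} (v : Fin (2*n)) : Mv v ∈ HGQ n := by
  intro i j _
  rw [Mv_apply, Mv_apply, show - av i + av v - (- av j + av v) = -(av i - av j) by ring]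
  exact (ax_dvd_sub i j).neg_right

lemma ax_dvd_prod_sub {n : ℕ} {i j : Fin (2*n)} {s : Finset (Fin (2*n))} (hij : i ≠ j)
    (hi : bar i ∈ s) (hj : bar j ∈ s) :
    ax i j ∣ ∏ k ∈ s, ax i k - ∏ k ∈ s, ax j k := by
  have hb : bar j ≠ bar i := fun h => hij (by rw [← bar_bar i, ← h, bar_bar])
  have hj' : bar j ∈ s.erase (bar i) := mem_erase.mpr ⟨hb, hj⟩
  rw [← mul_prod_erase s _ hi, ← mul_prod_erase s _ hi, ← mul_prod_erase _ _ hj',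
    ← mul_prod_erase _ _ hj', ← mul_assoc, ← mul_assoc,
    show ax i (bar i) = - av i by simp [ax], show ax j (bar j) = - av j by simp [ax],
    show ax i (bar j) = - av i - av j by simp [ax, hb, av_bar]; ring,
    show ax j (bar i) = - av i - av j by simp [ax, hb.symm, av_bar]; ring]
  have hd := Ideal.mem_span_singleton.mpr (ax_dvd_sub i j)
  rw [← Ideal.mem_span_singleton, ← Ideal.Quotient.eq]
  have ha := Ideal.Quotient.eq.mpr hd
  simp only [map_mul, map_sub, map_neg, map_prod, ha]
  rw [mul_comm (-_ - _)]
  congr 1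
  refine prod_congr rfl fun k hk => ?_
  simp only [mem_erase] at hk
  rw [show ax i k = - av i + av k by simp [ax, hk.2.1],
    show ax j k = - av j + av k by simp [ax, hk.1], map_add, map_add, map_neg, map_neg, ha]

lemma Del_mem {n : ℕ} {K : Finset (Fin (2*n))} (hK : ∀ i ∈ K, bar i ∉ K) : Del K ∈ HGQ n := by
  intro i j hij
  unfold Del
  split_ifs with hi hj hj
  · exact ax_dvd_prod_sub hij (mem_compl.mpr (hK i hi)) (mem_compl.mpr (hK j hj))
  · rw [sub_zero]
    exact dvd_prod_of_mem _ (mem_compl.mpr hj)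
  · rw [zero_sub, dvd_neg, ← neg_neg (ax i j), ← ax_swap, neg_dvd]
    exact dvd_prod_of_mem _ (mem_compl.mpr hi)
  · simp

lemma basisFun_mem {n : ℕ} (k : Fin (2*n)) : basisFun k ∈ HGQ n := by
  unfold basisFun
  split_ifs with h
  · exact Subring.prod_mem _ fun j _ => Mv_mem j
  · refine Del_mem fun i hi hb => ?_
    simp only [mem_filter, mem_univ, true_and, bar] at hi hb
    omega

lemma basisFun_apply_of_lt {n : ℕ} {k j : Fin (2*n)} (h : j < k) : basisFun k j = 0 := by
  unfold basisFun
  split_ifs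
  · rw [Finset.prod_apply]
    exact prod_eq_zero (i := j) (by simpa using h) (by rw [Mv_apply]; ring)
  · simp [Del, h]

lemma basisFun_apply_self {n : ℕ} (k : Fin (2*n)) :
    basisFun k k = ∏ j ∈ univ.filter (fun j : Fin (2*n) => j < k), ax k j := by
  unfold basisFun
  split_ifs with h
  · rw [Finset.prod_apply]
    refine prod_congr rfl fun j hj => ?_
    have hb : j ≠ bar k := by
      intro e
      have e := congrArg Fin.val e
      have hj : j.val < k.val := by simpa using hj
      simp only [bar] at e
      omega
    simp [Mv_apply, ax, hb]
  · simp only [Del, mem_filter, mem_univ, le_refl, and_self, if_true]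
    refine prod_congr ?_ fun _ _ => rfl
    ext j
    simp

lemma basisFun_apply_self_dvd {n : ℕ} {k : Fin (2*n)} {g : Fin (2*n) → Rr n} (hg : g ∈ HGQ n)
    (h : ∀ j < k, g j = 0) : basisFun k k ∣ g k := by
  rw [basisFun_apply_self]
  refine prod_ax_dvd (by simp) fun j hj => ?_
  have hj : j < k := by simpa using hj
  simpa [h j hj] using hg k j hj.ne'

lemma const_smul_mem {n : ℕ} (c : Rr n) {g : Fin (2*n) → Rr n} (hg : g ∈ HGQ n) :
    c • g ∈ HGQ n := by
  intro i j hij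
  simp only [Pi.smul_apply, smul_eq_mul, ← mul_sub]
  exact (hg i j hij).mul_left c

lemma mem_span_basisFun {n : ℕ} (d : ℕ) (g : Fin (2*n) → Rr n) (hg : g ∈ HGQ n)
    (h : ∀ j : Fin (2*n), j.val + d < 2*n → g j = 0) :
    g ∈ Submodule.span (Rr n) (Set.range (basisFun (n := n))) := by
  induction d generalizing g with
  | zero =>
    rw [show g = 0 from funext fun j => h j j.isLt]
    exact zero_mem _
  | succ d ih =>
    by_cases hd : d < 2*n
    · let k : Fin (2*n) := ⟨2*n - 1 - d, by omega⟩
      have hk : ∀ j < k, g j = 0 := fun j hj => h j (by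
        have : j.val < 2*n - 1 - d := hj
        omega)
      obtain ⟨c, hc⟩ := basisFun_apply_self_dvd hg hk
      rw [← sub_add_cancel g (c • basisFun k)]
      refine add_mem (ih _ (sub_mem hg (const_smul_mem c (basisFun_mem k))) fun j hj => ?_)
        (Submodule.smul_mem _ _ (Submodule.subset_span ⟨k, rfl⟩))
      have hjk : j ≤ k := by
        change j.val ≤ 2*n - 1 - d
        omega
      rcases hjk.lt_or_eq with hlt | rfl
      · simp [hk j hlt, basisFun_apply_of_lt hlt]
      · simp [hc, mul_comm]
    · exact ih g hg fun j hj => absurd hj (by omega)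

/-- every f ∈ H*(GQ_{2n−1}) is an R-linear combination of
1, M_1, M_1M_2, …, M_1⋯M_{n−1}, Δ_{{n+1,…,2n}}, …, Δ_{{2n}} (coefficients acting as
constant functions, products pointwise). -/
theorem stmt10 (n : ℕ) (hn : 1 ≤ n) (f : Fin (2*n) → Rr n) (hf : f ∈ HGQ n) :
    ∃ h : Fin (2*n) → Rr n,
      f = ∑ k : Fin (2*n), Function.const (Fin (2*n)) (h k) * basisFun k := by
  obtain ⟨h, hh⟩ := (Submodule.mem_span_range_iff_exists_fun (Rr n)).mp
    (mem_span_basisFun (2*n) f hf fun j hj => absurd hj (by omega))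
  exact ⟨h, hh.symm⟩

end
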